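/- arXiv:2503.23382 — 3 statements merged into one kernel-verified Lean document; each statement's English description precedes it below -/
import Mathlib

section
/- The set {h ∈ ℤ¹⁰ : Q(h,h) = −1, Q(h,T) = 1, Q(h,S) = 0, Q(h,S') = 0} is finite and has exactly 56 elements. (This is the set of homology classes of sections of E(1) disjoint from two fixed disjoint sections S, S'; equivalently, the classes of the 56 lines on a del Pezzo surface of degree 2.) -/
/-- The intersection form of `E(1) = CP² # 9 CP̄²` on `ℤ¹⁰`:
`Q(x,y) = x₀y₀ − Σ_{i=1}^{9} xᵢyᵢ`. -/
def Q (x y : Fin 10 → ℤ) : ℤ := x 0 * y 0 - ∑ i : Fin 9, x i.succ * y i.succ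

/-- The class of a fibre. -/
def T : Fin 10 → ℤ := ![3, -1, -1, -1, -1, -1, -1, -1, -1, -1]

/-- The class of a section (the last exceptional class). -/
def S : Fin 10 → ℤ := ![0, 0, 0, 0, 0, 0, 0, 0, 0, 1]

/-- The class of a second section, disjoint from `S`. -/
def S' : Fin 10 → ℤ := ![0, 0, 0, 0, 0, 0, 0, 0, 1, 0]

/-- The class `a H - ∑ bᵢ Eᵢ` with vanishing coefficients along the last two exceptional classes. -/
def classOf (a : ℤ) (b : Fin 7 → ℤ) : Fin 10 → ℤ :=
  ![a, -b 0, -b 1, -b 2, -b 3, -b 4, -b 5, -b 6, 0, 0]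

theorem classOf_injective2 : Function.Injective2 classOf := by
  intro a a' b b' h
  refine ⟨congrFun h 0, funext fun i => ?_⟩
  have hi := congrFun h (Fin.castAdd 2 i).succ
  fin_cases i <;> exact neg_injective hi

theorem section_iff_exists_classOf (h : Fin 10 → ℤ) :
    (Q h h = -1 ∧ Q h T = 1 ∧ Q h S = 0 ∧ Q h S' = 0) ↔
      ∃ a b, classOf a b = h ∧ ∑ i, b i = 3 * a - 1 ∧ ∑ i, b i ^ 2 = a ^ 2 + 1 := by
  constructor
  · rintro ⟨hh, hT, hS, hS'⟩
    simp [Q, T, S, S', Fin.sum_univ_succ] at hh hT hS hS'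
    refine ⟨h 0, fun i => -h (Fin.castAdd 2 i).succ, ?_, ?_, ?_⟩
    · funext j
      fin_cases j <;> simp [classOf] <;> first | rfl | exact hS.symm | exact hS'.symm
    · simp [Fin.sum_univ_seven]
      linarith
    · simp [Fin.sum_univ_seven]
      simp [hS, hS'] at hh
      linarith
  · rintro ⟨a, b, rfl, h₁, h₂⟩
    simp only [Fin.sum_univ_seven] at h₁ h₂
    simp [Q, T, S, S', classOf, Fin.sum_univ_succ]
    constructor <;> linarith

/-- The smaller of the two consecutive values taken by the multiplicities of a section of
degree `a`. -/
def minMult : Fin 4 → ℤ := ![-1, 0, 0, 1]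

/-- The number of multiplicities of a section of degree `a` that exceed `minMult a` by one. -/
def excess : Fin 4 → ℕ := ![6, 2, 5, 1]

theorem sum_minMult (a : Fin 4) : 7 * minMult a + excess a = 3 * (a : ℕ) - 1 := by
  revert a; decide

theorem sum_sq_minMult (a : Fin 4) :
    7 * minMult a ^ 2 + (2 * minMult a + 1) * excess a = ((a : ℕ) : ℤ) ^ 2 + 1 := by
  revert a; decide

/-- The multiplicities equal to `c + 1` on `s` and to `c` elsewhere. -/
def twoValued (c : ℤ) (s : Finset (Fin 7)) (i : Fin 7) : ℤ := c + if i ∈ s then 1 else 0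

theorem twoValued_injective (c : ℤ) : Function.Injective (twoValued c) := by
  intro s t h
  ext i
  have hi := congrFun h i
  by_cases hs : i ∈ s <;> by_cases ht : i ∈ t <;> simp_all [twoValued]

theorem sum_twoValued (c : ℤ) (s : Finset (Fin 7)) :
    ∑ i, twoValued c s i = 7 * c + s.card := by
  simp [twoValued, Finset.sum_add_distrib]

theorem sum_sq_twoValued (c : ℤ) (s : Finset (Fin 7)) :
    ∑ i, twoValued c s i ^ 2 = 7 * c ^ 2 + (2 * c + 1) * s.card := by
  have h (i : Fin 7) : twoValued c s i ^ 2 = c ^ 2 + (2 * c + 1) * if i ∈ s then 1 else 0 := by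
    unfold twoValued
    split_ifs <;> ring
  simp [h, Finset.sum_add_distrib, mul_comm]

theorem exists_eq_twoValued {c : ℤ} {k : ℕ} {b : Fin 7 → ℤ} (h₁ : ∑ i, b i = 7 * c + k)
    (h₂ : ∑ i, b i ^ 2 = 7 * c ^ 2 + (2 * c + 1) * k) :
    ∃ s : Finset (Fin 7), s.card = k ∧ twoValued c s = b := by
  have hsum : ∑ i, (b i - c) * (b i - c - 1) = 0 := by
    have h (i : Fin 7) :
        (b i - c) * (b i - c - 1) = b i ^ 2 - (2 * c + 1) * b i + (c ^ 2 + c) := by ring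
    simp only [h, Finset.sum_add_distrib, Finset.sum_sub_distrib, ← Finset.mul_sum, h₁, h₂]
    simp
    ring
  have hnonneg (i : Fin 7) : 0 ≤ (b i - c) * (b i - c - 1) := by
    rcases le_or_gt (b i - c) 0 with h | h
    · exact mul_nonneg_of_nonpos_of_nonpos h (by lia)
    · exact mul_nonneg h.le (by lia)
  have hzero (i : Fin 7) : (b i - c) * (b i - c - 1) = 0 :=
    (Finset.sum_eq_zero_iff_of_nonneg fun i _ => hnonneg i).1 hsum i (Finset.mem_univ i)
  have hb : twoValued c {i | b i = c + 1} = b := by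
    funext i
    rcases mul_eq_zero.1 (hzero i) with h | h <;> simp [twoValued] <;> split_ifs <;> lia
  refine ⟨_, ?_, hb⟩
  have hcard := sum_twoValued c {i | b i = c + 1}
  rw [hb] at hcard
  lia

theorem degree_bounds {a : ℤ} {b : Fin 7 → ℤ} (h₁ : ∑ i, b i = 3 * a - 1)
    (h₂ : ∑ i, b i ^ 2 = a ^ 2 + 1) : 0 ≤ a ∧ a < 4 := by
  have h := sq_sum_le_card_mul_sum_sq (s := Finset.univ) (f := b)
  rw [h₁, h₂] at h
  simp at h
  constructor <;> nlinarith

/-- The section class of degree `x.1` whose larger multiplicities are supported on `x.2`. -/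
def sectionClass (x : (_ : Fin 4) × Finset (Fin 7)) : Fin 10 → ℤ :=
  classOf (x.1 : ℕ) (twoValued (minMult x.1) x.2)

theorem sectionClass_injective : Function.Injective sectionClass := by
  rintro ⟨a, s⟩ ⟨a', s'⟩ h
  obtain ⟨ha, hs⟩ := classOf_injective2 h
  obtain rfl : a = a' := Fin.ext (by exact_mod_cast ha)
  obtain rfl : s = s' := twoValued_injective _ hs
  rfl

theorem setOf_sections_eq_image :
    {h : Fin 10 → ℤ | Q h h = -1 ∧ Q h T = 1 ∧ Q h S = 0 ∧ Q h S' = 0} =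
      ((Finset.univ.sigma fun a => Finset.powersetCard (excess a) Finset.univ).image
        sectionClass : Finset (Fin 10 → ℤ)) := by
  ext h
  simp only [Set.mem_ofPred_eq, section_iff_exists_classOf, Finset.coe_image, Set.mem_image,
    Finset.mem_coe, Finset.mem_sigma, Finset.mem_univ, true_and, Finset.mem_powersetCard_univ]
  constructor
  · rintro ⟨a, b, rfl, h₁, h₂⟩
    obtain ⟨h0, h4⟩ := degree_bounds h₁ h₂
    lift a to ℕ using h0
    obtain ⟨d, rfl⟩ : ∃ d : Fin 4, (d : ℕ) = a := ⟨⟨a, by lia⟩, rfl⟩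
    rw [← sum_minMult] at h₁
    rw [← sum_sq_minMult] at h₂
    obtain ⟨s, hs, rfl⟩ := exists_eq_twoValued h₁ h₂
    exact ⟨⟨d, s⟩, hs, rfl⟩
  · rintro ⟨⟨a, s⟩, hs, rfl⟩
    refine ⟨_, _, rfl, ?_, ?_⟩
    · rw [sum_twoValued, hs, sum_minMult]
    · rw [sum_sq_twoValued, hs, sum_sq_minMult]

/-- The set of classes of sections of `E(1)` disjoint from the two fixed disjoint
sections `S, S'` (equivalently, of the lines on a del Pezzo surface of degree 2)
is finite and has exactly `56` elements. -/
theorem sections_disjoint_from_two_sections_card :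
    {h : Fin 10 → ℤ | Q h h = -1 ∧ Q h T = 1 ∧ Q h S = 0 ∧ Q h S' = 0}.Finite ∧
      {h : Fin 10 → ℤ | Q h h = -1 ∧ Q h T = 1 ∧ Q h S = 0 ∧ Q h S' = 0}.ncard = 56 := by
  rw [setOf_sections_eq_image]
  refine ⟨Finset.finite_toSet _, ?_⟩
  rw [Set.ncard_coe_finset, Finset.card_image_of_injective _ sectionClass_injective,
    Finset.card_sigma]
  simp only [Finset.card_powersetCard, Finset.card_univ, Fintype.card_fin]
  decide
end

section
/- The set {h ∈ ℤ¹⁰ : Q(h,h) = −1, Q(h,T) = 1, Q(h,S) = 0, Q(h,S') = 0, Q(h,S'') = 0} is finite and has exactly 27 elements. (This is the set of homology classes of sections of E(1) disjoint from three fixed pairwise disjoint sections; equivalently, the classes of the 27 lines on a cubic del Pezzo surface of degree 3.) -/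
/-- The class of a third section, disjoint from `S` and `S'`. -/
def S'' : Fin 10 → ℤ := ![0, 0, 0, 0, 0, 0, 0, 1, 0, 0]

/-- An integer-valued function with `∑ f = c * k` and `∑ f² = k`, where `c = ±1`, takes the value
`c` on a set of size `k` and vanishes elsewhere. -/
theorem exists_finset_eq_ite_of_sum_eq {ι : Type*} [Fintype ι] [DecidableEq ι] {c : ℤ} {k : ℕ}
    (hc : c = 1 ∨ c = -1) {f : ι → ℤ} (h₁ : ∑ i, f i = c * k) (h₂ : ∑ i, f i ^ 2 = k) :
    ∃ s : Finset ι, s.card = k ∧ f = fun i => if i ∈ s then c else 0 := by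
  have hcc : c * c = 1 := by rcases hc with rfl | rfl <;> rfl
  have hsum : ∑ i, (f i ^ 2 - c * f i) = 0 := by
    rw [Finset.sum_sub_distrib, ← Finset.mul_sum, h₁, h₂, ← mul_assoc, hcc, one_mul, sub_self]
  have hnonneg : ∀ i ∈ Finset.univ, 0 ≤ f i ^ 2 - c * f i := fun i _ => by
    have := Int.le_self_sq (f i)
    have := Int.le_self_sq (-f i)
    rcases hc with rfl | rfl <;> linarith [neg_sq (f i)]
  have hval : ∀ i, f i = 0 ∨ f i = c := fun i => by
    have hi := (Finset.sum_eq_zero_iff_of_nonneg hnonneg).1 hsum i (Finset.mem_univ i)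
    have : f i * (f i - c) = 0 := by linear_combination hi
    exact (mul_eq_zero.1 this).imp_right sub_eq_zero.1
  have hf : f = fun i => if i ∈ Finset.univ.filter (fun i => f i = c) then c else 0 := by
    funext i
    have := hval i
    simp only [Finset.mem_filter, Finset.mem_univ, true_and]
    split_ifs with h
    · exact h
    · exact this.resolve_right h
  refine ⟨_, ?_, hf⟩
  rw [hf, Finset.sum_ite_mem, Finset.univ_inter, Finset.sum_const, nsmul_eq_mul, mul_comm] at h₁
  exact_mod_cast mul_left_cancel₀ (left_ne_zero_of_mul_eq_one hcc) h₁

/-- The class with degree `a` and coefficient `c` on the exceptional classes indexed by `s`. -/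
def signedClass (a c : ℤ) (s : Finset (Fin 9)) : Fin 10 → ℤ :=
  Fin.cons a fun i => if i ∈ s then c else 0

theorem signedClass_injective (a : ℤ) {c : ℤ} (hc : c ≠ 0) :
    Function.Injective (signedClass a c) := fun s t h => by
  ext i
  have := congrFun h i.succ
  simp only [signedClass, Fin.cons_succ] at this
  split_ifs at this <;> simp_all

theorem disjoint_image_signedClass {a b : ℤ} (hab : a ≠ b) (c d : ℤ)
    (A B : Finset (Finset (Fin 9))) :
    Disjoint (A.image (signedClass a c)) (B.image (signedClass b d)) := by
  simp only [Finset.disjoint_left, Finset.mem_image]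
  rintro _ ⟨s, -, rfl⟩ ⟨t, -, h⟩
  exact hab (congrFun h 0).symm

/-- The section conditions in coordinates. -/
theorem section_conditions_iff (h : Fin 10 → ℤ) :
    (Q h h = -1 ∧ Q h T = 1 ∧ Q h S = 0 ∧ Q h S' = 0 ∧ Q h S'' = 0) ↔
      ∑ i : Fin 9, h i.succ ^ 2 = h 0 ^ 2 + 1 ∧ ∑ i : Fin 9, h i.succ = 1 - 3 * h 0 ∧
        ∀ i : Fin 9, i ∉ Finset.Iio 6 → h i.succ = 0 := by
  have hT : Q h T = 3 * h 0 + ∑ i : Fin 9, h i.succ := by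
    simp [Q, T, Fin.sum_univ_succ]; ring
  have hS : Q h S = -h 9 := by simp [Q, S, Fin.sum_univ_succ]
  have hS' : Q h S' = -h 8 := by simp [Q, S', Fin.sum_univ_succ]
  have hS'' : Q h S'' = -h 7 := by simp [Q, S'', Fin.sum_univ_succ]
  have hQ : Q h h = h 0 ^ 2 - ∑ i : Fin 9, h i.succ ^ 2 := by simp only [Q, sq]
  have hvan : (∀ i : Fin 9, i ∉ Finset.Iio 6 → h i.succ = 0) ↔ h 9 = 0 ∧ h 8 = 0 ∧ h 7 = 0 := by
    constructor
    · exact fun H => ⟨H 8 (by decide), H 7 (by decide), H 6 (by decide)⟩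
    · rintro ⟨h9, h8, h7⟩ i hi
      fin_cases i <;> first | assumption | exact absurd (by decide) hi
  rw [hT, hS, hS', hS'', hQ, hvan]
  constructor <;> rintro ⟨h₁, h₂, h₃, h₄, h₅⟩ <;> refine ⟨?_, ?_, ?_, ?_, ?_⟩ <;> linarith

/-- The degree of a section class disjoint from `S, S', S''` is `0`, `1` or `2`. -/
theorem degree_mem_of_sums {a : ℤ} {f : Fin 9 → ℤ} (h₁ : ∑ i, f i ^ 2 = a ^ 2 + 1)
    (h₂ : ∑ i, f i = 1 - 3 * a) (h₃ : ∀ i, i ∉ Finset.Iio 6 → f i = 0) :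
    a = 0 ∨ a = 1 ∨ a = 2 := by
  have hcs := sq_sum_le_card_mul_sum_sq (s := Finset.Iio (6 : Fin 9)) (f := f)
  have hf : ∑ i < (6 : Fin 9), f i = ∑ i, f i :=
    Finset.sum_subset (Finset.subset_univ _) fun i _ hi => h₃ i hi
  have hf' : ∑ i < (6 : Fin 9), f i ^ 2 = ∑ i, f i ^ 2 :=
    Finset.sum_subset (Finset.subset_univ _) fun i _ hi => by rw [h₃ i hi, zero_pow two_ne_zero]
  rw [hf, hf', h₁, h₂, Fin.card_Iio] at hcs
  norm_num at hcs
  have : 0 ≤ a := by nlinarith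
  have : a ≤ 2 := by nlinarith
  lia

/-- The classes `eᵢ`, `ℓ - eᵢ - eⱼ` and `2 • ℓ - ∑_{j ≠ i} eⱼ` of the `27` lines
on a cubic surface. -/
def lineClasses : Finset (Fin 10 → ℤ) :=
  ((Finset.Iio 6).powersetCard 1).image (signedClass 0 1) ∪
    (((Finset.Iio 6).powersetCard 2).image (signedClass 1 (-1)) ∪
      ((Finset.Iio 6).powersetCard 5).image (signedClass 2 (-1)))

theorem card_lineClasses : lineClasses.card = 27 := by
  rw [lineClasses, Finset.card_union_of_disjoint, Finset.card_union_of_disjoint,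
    Finset.card_image_of_injective _ (signedClass_injective 0 (by decide)),
    Finset.card_image_of_injective _ (signedClass_injective 1 (by decide)),
    Finset.card_image_of_injective _ (signedClass_injective 2 (by decide))]
  · simp only [Finset.card_powersetCard, Fin.card_Iio]
    rfl
  · exact disjoint_image_signedClass (by decide) _ _ _ _
  · exact Finset.disjoint_union_right.2 ⟨disjoint_image_signedClass (by decide) _ _ _ _,
      disjoint_image_signedClass (by decide) _ _ _ _⟩

theorem section_conditions_signedClass {a c : ℤ} {k : ℕ} (h₁ : k * c ^ 2 = a ^ 2 + 1)
    (h₂ : k * c = 1 - 3 * a) {s : Finset (Fin 9)}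
    (hs : s ∈ (Finset.Iio 6).powersetCard k) :
    Q (signedClass a c s) (signedClass a c s) = -1 ∧ Q (signedClass a c s) T = 1 ∧
      Q (signedClass a c s) S = 0 ∧ Q (signedClass a c s) S' = 0 ∧
        Q (signedClass a c s) S'' = 0 := by
  obtain ⟨hsub, rfl⟩ := Finset.mem_powersetCard.1 hs
  rw [section_conditions_iff]
  simp only [signedClass, Fin.cons_succ, Fin.cons_zero]
  refine ⟨?_, ?_, fun i hi => if_neg fun h => hi (hsub h)⟩
  · simpa [ite_pow] using h₁
  · simpa using h₂

theorem mem_image_signedClass {a c : ℤ} {k : ℕ} (hc : c = 1 ∨ c = -1) {h : Fin 10 → ℤ}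
    (ha : h 0 = a) (h₁ : ∑ i : Fin 9, h i.succ = c * k) (h₂ : ∑ i : Fin 9, h i.succ ^ 2 = k)
    (h₃ : ∀ i : Fin 9, i ∉ Finset.Iio 6 → h i.succ = 0) :
    h ∈ ((Finset.Iio 6).powersetCard k).image (signedClass a c) := by
  obtain ⟨s, hs, hf⟩ := exists_finset_eq_ite_of_sum_eq hc h₁ h₂
  refine Finset.mem_image.2 ⟨s, Finset.mem_powersetCard.2 ⟨fun i hi => ?_, hs⟩, ?_⟩
  · by_contra hi'
    have := (congrFun hf i).symm.trans (h₃ i hi')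
    rw [if_pos hi] at this
    lia
  · funext i
    refine Fin.cases ha.symm (fun j => ?_) i
    exact (congrFun hf j).symm

theorem mem_lineClasses_iff (h : Fin 10 → ℤ) :
    h ∈ lineClasses ↔ Q h h = -1 ∧ Q h T = 1 ∧ Q h S = 0 ∧ Q h S' = 0 ∧ Q h S'' = 0 := by
  simp only [lineClasses, Finset.mem_union]
  constructor
  · rintro (H | H | H) <;> obtain ⟨s, hs, rfl⟩ := Finset.mem_image.1 H <;>
      exact section_conditions_signedClass (by norm_num) (by norm_num) hs
  · rw [section_conditions_iff]
    rintro ⟨h₁, h₂, h₃⟩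
    rcases degree_mem_of_sums h₁ h₂ h₃ with ha | ha | ha <;> rw [ha] at h₁ h₂
    · exact Or.inl (mem_image_signedClass (Or.inl rfl) ha h₂ h₁ h₃)
    · exact Or.inr (Or.inl (mem_image_signedClass (Or.inr rfl) ha h₂ h₁ h₃))
    · exact Or.inr (Or.inr (mem_image_signedClass (Or.inr rfl) ha h₂ h₁ h₃))

/-- The set of classes of sections of `E(1)` disjoint from the three fixed pairwise
disjoint sections `S, S', S''` (equivalently, of the `27` lines on a cubic del Pezzo
surface of degree 3) is finite and has exactly `27` elements. -/
theorem sections_disjoint_from_three_sections_card :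
    {h : Fin 10 → ℤ | Q h h = -1 ∧ Q h T = 1 ∧ Q h S = 0 ∧ Q h S' = 0 ∧ Q h S'' = 0}.Finite ∧
      {h : Fin 10 → ℤ |
        Q h h = -1 ∧ Q h T = 1 ∧ Q h S = 0 ∧ Q h S' = 0 ∧ Q h S'' = 0}.ncard = 27 := by
  have hset : {h : Fin 10 → ℤ |
      Q h h = -1 ∧ Q h T = 1 ∧ Q h S = 0 ∧ Q h S' = 0 ∧ Q h S'' = 0} = lineClasses :=
    Set.ext fun h => (mem_lineClasses_iff h).symm
  rw [hset]
  exact ⟨lineClasses.finite_toSet, by rw [Set.ncard_coe_finset, card_lineClasses]⟩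
end

section
/- There exist vectors b₀, b₁, …, b₇ ∈ ℤ¹⁰ such that Q(b_i, S) = 0 and Q(b_i, T) = 0 for all i, the Gram matrix satisfies Q(b_i, b_j) = G_{ij} for all i, j (where G is the E8 Gram matrix), and every v ∈ ℤ¹⁰ with Q(v,S) = Q(v,T) = 0 can be written uniquely as an integer linear combination of b₀, …, b₇. In other words, the orthogonal complement of ⟨S, T⟩ in (ℤ¹⁰, Q) is isometric to the negative definite E8 lattice. -/
/-- The Gram matrix of the negative definite `E8` lattice (Dynkin diagram with
edges `{1,2},{2,3},{3,4},{4,5},{5,6},{6,7},{0,3}`). -/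
def G : Matrix (Fin 8) (Fin 8) ℤ :=
  !![-2, 0, 0, 1, 0, 0, 0, 0;
      0,-2, 1, 0, 0, 0, 0, 0;
      0, 1,-2, 1, 0, 0, 0, 0;
      1, 0, 1,-2, 1, 0, 0, 0;
      0, 0, 0, 1,-2, 1, 0, 0;
      0, 0, 0, 0, 1,-2, 1, 0;
      0, 0, 0, 0, 0, 1,-2, 1;
      0, 0, 0, 0, 0, 0, 1,-2]

/-- The simple roots `h - e₁ - e₂ - e₃` and `eᵢ - eᵢ₊₁` (`1 ≤ i ≤ 7`) of the `E8` lattice. -/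
def simpleRoots : Fin 8 → Fin 10 → ℤ :=
  ![![1, -1, -1, -1, 0, 0, 0, 0, 0, 0],
    ![0, 1, -1, 0, 0, 0, 0, 0, 0, 0],
    ![0, 0, 1, -1, 0, 0, 0, 0, 0, 0],
    ![0, 0, 0, 1, -1, 0, 0, 0, 0, 0],
    ![0, 0, 0, 0, 1, -1, 0, 0, 0, 0],
    ![0, 0, 0, 0, 0, 1, -1, 0, 0, 0],
    ![0, 0, 0, 0, 0, 0, 1, -1, 0, 0],
    ![0, 0, 0, 0, 0, 0, 0, 1, -1, 0]]

theorem sum_smul_simpleRoots (c : Fin 8 → ℤ) :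
    ∑ i, c i • simpleRoots i =
      ![c 0, c 1 - c 0, c 2 - c 1 - c 0, c 3 - c 2 - c 0, c 4 - c 3, c 5 - c 4,
        c 6 - c 5, c 7 - c 6, -c 7, 0] := by
  funext k
  fin_cases k <;> simp [simpleRoots, Fin.sum_univ_eight] <;> ring

theorem Q_apply_S (v : Fin 10 → ℤ) : Q v S = -v 9 := by
  simp [Q, S, Fin.sum_univ_succ]

theorem Q_apply_T (v : Fin 10 → ℤ) :
    Q v T = 3 * v 0 + (v 1 + v 2 + v 3 + v 4 + v 5 + v 6 + v 7 + v 8 + v 9) := by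
  simp [Q, T, Fin.sum_univ_succ]
  ring

/-- The orthogonal complement of `⟨S,T⟩` in `(ℤ¹⁰, Q)` is isometric to the negative
definite `E8` lattice: there is a basis `b₀,…,b₇` of it with Gram matrix `G`. -/
theorem orthogonal_complement_isometric_E8 :
    ∃ b : Fin 8 → (Fin 10 → ℤ),
      (∀ i, Q (b i) S = 0 ∧ Q (b i) T = 0) ∧
      (∀ i j, Q (b i) (b j) = G i j) ∧
      (∀ v : Fin 10 → ℤ, Q v S = 0 → Q v T = 0 →
        ∃! c : Fin 8 → ℤ, v = ∑ i, c i • b i) := by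
  refine ⟨simpleRoots, by decide, fun i j => by fin_cases i <;> fin_cases j <;> rfl, fun v hS hT => ?_⟩
  rw [Q_apply_S] at hS
  rw [Q_apply_T] at hT
  simp only [sum_smul_simpleRoots]
  refine ⟨![v 0, v 0 + v 1, 2 * v 0 + v 1 + v 2, 3 * v 0 + v 1 + v 2 + v 3,
    3 * v 0 + v 1 + v 2 + v 3 + v 4, 3 * v 0 + v 1 + v 2 + v 3 + v 4 + v 5,
    3 * v 0 + v 1 + v 2 + v 3 + v 4 + v 5 + v 6,
    3 * v 0 + v 1 + v 2 + v 3 + v 4 + v 5 + v 6 + v 7], ?_, fun c hc => ?_⟩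
  · funext k
    fin_cases k <;> simp <;> lia
  · rw [hc]
    funext k
    fin_cases k <;> simp <;> ring
end
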